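/- Let (P_t)_{t∈I} be a Markov semigroup on X indexed by I ⊆ [0,∞) and let Λ be a fixed collection of distance-like functions ρ : X × X → [0,1]. Assume: (A1) there exist a continuous ψ : [0,∞) → [0,∞) with ψ(t) → 0 as t → ∞ and constants α₀ > 0, C₀ > 0 such that ∫_X exp(α‖u‖²) P_t(u₀,du) ≤ exp(α(ψ(t)‖u₀‖² + C₀)) for all α ∈ (0,α₀], t ∈ I, u₀ ∈ X; (A2) for every M > 0 there exists κ₁ = κ₁(M) ∈ (0,1) such that for every ρ ∈ Λ there exists T₁ = T₁(M,ρ) > 0 with W_ρ(P_t(u₀,·), P_t(v₀,·)) ≤ 1 − κ₁ for all t ∈ I with t ≥ T₁ and all u₀, v₀ ∈ X with ‖u₀‖ ≤ M and ‖v₀‖ ≤ M; (A3.i) for every κ₂ ∈ (0,1) and r > 0 there exist ρ ∈ Λ and T₂ > 0 such that W_ρ(P_t(u₀,·), P_t(v₀,·)) ≤ κ₂ · exp(r‖u₀‖²) · ρ(u₀,v₀) for all t ∈ I with t ≥ T₂ and all u₀, v₀ ∈ X with ρ(u₀,v₀) < 1. Then for every real m ≥ 1 there exists α_m > 0 such that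 for each α ∈ (0,α_m] there exist ρ ∈ Λ, κ ∈ (0,1) and T > 0 such that W_{ρ_α}(μP_t, νP_t) ≤ κ · W_{ρ_{α/m}}(μ,ν) for every t ∈ I with t ≥ T and all Borel probability measures μ, ν on X. -/

import Mathlib

open MeasureTheory ENNReal Filter

noncomputable section

/-- A coupling of two Borel probability measures: a measure on the product whose
marginals are the given measures. -/
def IsCoupling {X : Type*} [MeasurableSpace X] (μ ν : Measure X)
    (Γ : Measure (X × X)) : Prop :=
  Γ.map Prod.fst = μ ∧ Γ.map Prod.snd = ν

/-- The Wasserstein-like extension of a distance-like function `ρ` to probability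
measures: the infimum over couplings of the integral of `ρ`. -/
noncomputable def wassLike {X : Type*} [MeasurableSpace X] (ρ : X → X → ℝ)
    (μ ν : Measure X) : ℝ≥0∞ :=
  ⨅ (Γ : Measure (X × X)) (_ : IsProbabilityMeasure Γ) (_ : IsCoupling μ ν Γ),
    ∫⁻ p, ENNReal.ofReal (ρ p.1 p.2) ∂Γ

/-- A distance-like function: nonnegative, symmetric, lower semicontinuous, and
vanishing exactly on the diagonal. -/
def DistanceLike {X : Type*} [TopologicalSpace X] (ρ : X → X → ℝ) : Prop :=
  (∀ u v, 0 ≤ ρ u v) ∧ (∀ u v, ρ u v = ρ v u) ∧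
    LowerSemicontinuous (fun p : X × X => ρ p.1 p.2) ∧
    (∀ u v, ρ u v = 0 ↔ u = v)

/-- A Markov kernel given as a measurable family of probability measures. -/
def IsMarkovKernelFun {X : Type*} [MeasurableSpace X] (P : X → Measure X) : Prop :=
  Measurable P ∧ ∀ u, IsProbabilityMeasure (P u)

/-- The weighted distance-like function `ρ_a(u,v) = ρ(u,v)^{1/2} exp(a‖u‖² + a‖v‖²)`. -/
noncomputable def expWeight {X : Type*} [NormedAddCommGroup X]
    (ρ : X → X → ℝ) (a : ℝ) (u v : X) : ℝ :=
  Real.sqrt (ρ u v) * Real.exp (a * ‖u‖ ^ 2 + a * ‖v‖ ^ 2)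

/-- The uniform mixture of the first `n + 1` measures of a sequence. -/
def uniformMixture {Y : Type*} [MeasurableSpace Y] (Q : ℕ → Measure Y) (n : ℕ) : Measure Y :=
  ((n + 1 : ℕ) : ℝ≥0∞)⁻¹ • ∑ i ∈ Finset.range (n + 1), Q i

section Mixture

variable {Y Z : Type*} [MeasurableSpace Y] [MeasurableSpace Z]

lemma uniformMixture_apply (Q : ℕ → Measure Y) (n : ℕ) (s : Set Y) :
    uniformMixture Q n s = ((n + 1 : ℕ) : ℝ≥0∞)⁻¹ * ∑ i ∈ Finset.range (n + 1), Q i s := by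
  simp [uniformMixture]

lemma isProbabilityMeasure_uniformMixture (Q : ℕ → Measure Y) (hQ : ∀ i, IsProbabilityMeasure (Q i))
    (n : ℕ) : IsProbabilityMeasure (uniformMixture Q n) := by
  constructor
  rw [uniformMixture_apply]
  simp only [measure_univ, Finset.sum_const, Finset.card_range, nsmul_eq_mul, mul_one]
  exact ENNReal.inv_mul_cancel (by simp) (ENNReal.natCast_ne_top _)

lemma map_uniformMixture (Q : ℕ → Measure Y) (n : ℕ) {f : Y → Z} (hf : Measurable f) :
    (uniformMixture Q n).map f = uniformMixture (fun i ↦ (Q i).map f) n := by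
  ext s hs
  rw [Measure.map_apply hf hs, uniformMixture_apply, uniformMixture_apply]
  simp_rw [Measure.map_apply hf hs]

lemma lintegral_uniformMixture (Q : ℕ → Measure Y) (n : ℕ) (f : Y → ℝ≥0∞) :
    ∫⁻ y, f y ∂(uniformMixture Q n)
      = ((n + 1 : ℕ) : ℝ≥0∞)⁻¹ * ∑ i ∈ Finset.range (n + 1), ∫⁻ y, f y ∂(Q i) := by
  rw [uniformMixture, lintegral_smul_measure, lintegral_finsetSum_measure, smul_eq_mul]

lemma uniformMixture_real_apply (Q : ℕ → Measure Y) (hQ : ∀ i, IsProbabilityMeasure (Q i))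
    (n : ℕ) (s : Set Y) :
    (uniformMixture Q n).real s
      = ((n + 1 : ℕ) : ℝ)⁻¹ • ∑ i ∈ Finset.range (n + 1), (Q i).real s := by
  rw [measureReal_def, uniformMixture_apply, ENNReal.toReal_mul,
    ENNReal.toReal_sum (fun i _ ↦ measure_ne_top _ _), ENNReal.toReal_inv, ENNReal.toReal_natCast,
    smul_eq_mul]
  rfl

end Mixture

/-- Strong law of large numbers for the coordinates of an infinite product of copies of `Γ`. -/
lemma ae_tendsto_average_infinitePi {Z : Type*} [MeasurableSpace Z] (Γ : Measure Z)
    [IsProbabilityMeasure Γ] {f : Z → ℝ} (hf : Measurable f) (hint : Integrable f Γ) :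
    ∀ᵐ ω ∂(Measure.infinitePi (fun _ : ℕ ↦ Γ)),
      Tendsto (fun n : ℕ ↦ ((n + 1 : ℕ) : ℝ)⁻¹ • ∑ i ∈ Finset.range (n + 1), f (ω i)) atTop
        (nhds (∫ z, f z ∂Γ)) := by
  have hmap (i : ℕ) : (Measure.infinitePi (fun _ : ℕ ↦ Γ)).map (fun ω ↦ ω i) = Γ :=
    Measure.infinitePi_map_eval _ i
  have hid (i : ℕ) : ProbabilityTheory.IdentDistrib (fun ω : ℕ → Z ↦ f (ω i))
      (fun ω : ℕ → Z ↦ f (ω 0)) (Measure.infinitePi (fun _ : ℕ ↦ Γ))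
      (Measure.infinitePi (fun _ : ℕ ↦ Γ)) := by
    have : ProbabilityTheory.IdentDistrib (fun ω : ℕ → Z ↦ ω i)
      (fun ω : ℕ → Z ↦ ω 0) (Measure.infinitePi (fun _ : ℕ ↦ Γ))
      (Measure.infinitePi (fun _ : ℕ ↦ Γ)) :=
      ⟨(measurable_pi_apply i).aemeasurable, (measurable_pi_apply 0).aemeasurable,
        by rw [hmap, hmap]⟩
    exact this.comp hf
  have hmp : MeasurePreserving (fun ω : ℕ → Z ↦ ω 0) (Measure.infinitePi (fun _ : ℕ ↦ Γ)) Γ :=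
    ⟨by fun_prop, hmap 0⟩
  have h := ProbabilityTheory.strong_law_ae (μ := Measure.infinitePi (fun _ : ℕ ↦ Γ))
    (fun i ω ↦ f (ω i)) (hmp.integrable_comp_of_integrable hint)
    (fun i j hij ↦ (ProbabilityTheory.iIndepFun_infinitePi (P := fun _ : ℕ ↦ Γ)
      (X := fun _ ↦ f) (fun _ ↦ hf)).indepFun hij) hid
  have hE : ∫ ω, f (ω 0) ∂(Measure.infinitePi (fun _ : ℕ ↦ Γ)) = ∫ z, f z ∂Γ := by
    conv_rhs => rw [← hmap 0]
    rw [integral_map (measurable_pi_apply 0).aemeasurable (by exact hf.aestronglyMeasurable)]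
  rw [hE] at h
  filter_upwards [h] with ω hω
  exact (tendsto_add_atTop_iff_nat 1).2 hω

/-- In a second countable space there is a countable π-system of open sets which is a basis. -/
lemma exists_countable_isPiSystem_isTopologicalBasis (X : Type*) [TopologicalSpace X]
    [SecondCountableTopology X] :
    ∃ S : Set (Set X), S.Countable ∧ IsPiSystem S ∧ TopologicalSpace.IsTopologicalBasis S := by
  obtain ⟨b, hbc, -, hb⟩ := TopologicalSpace.exists_countable_basis X
  refine ⟨(fun F ↦ ⋂₀ F) '' {F | F.Finite ∧ F ⊆ b}, (Set.countable_ofPred_finite_subset hbc).image _,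
    ?_, ?_⟩
  · rintro _ ⟨F, ⟨hF, hFb⟩, rfl⟩ _ ⟨G, ⟨hG, hGb⟩, rfl⟩ -
    exact ⟨F ∪ G, ⟨hF.union hG, Set.union_subset hFb hGb⟩, Set.sInter_union F G⟩
  · refine TopologicalSpace.isTopologicalBasis_of_isOpen_of_nhds ?_ ?_
    · rintro _ ⟨F, ⟨hF, hFb⟩, rfl⟩
      exact hF.isOpen_sInter fun s hs ↦ hb.isOpen (hFb hs)
    · intro x u hx hu
      obtain ⟨v, hv, hxv, hvu⟩ := hb.exists_subset_of_mem_open hx hu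
      exact ⟨v, ⟨{v}, ⟨Set.finite_singleton v, by simpa using hv⟩, by simp⟩, hxv, hvu⟩

/-- Almost surely, the mixtures of a Markov kernel along an i.i.d. sample converge weakly to the
averaged kernel. -/
lemma ae_tendsto_uniformMixture {Z X : Type*} [MeasurableSpace Z] [TopologicalSpace X]
    [SecondCountableTopology X] [MeasurableSpace X] [BorelSpace X]
    (Γ : Measure Z) [IsProbabilityMeasure Γ] {Q : Z → Measure X} (hQ : Measurable Q)
    (hQp : ∀ z, IsProbabilityMeasure (Q z)) (hB : IsProbabilityMeasure (Γ.bind Q)) :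
    ∀ᵐ ω ∂(Measure.infinitePi (fun _ : ℕ ↦ Γ)),
      Tendsto (β := ProbabilityMeasure X) (fun n ↦ (⟨uniformMixture (fun i ↦ Q (ω i)) n,
        isProbabilityMeasure_uniformMixture _ (fun i ↦ hQp (ω i)) n⟩ : ProbabilityMeasure X)) atTop
        (nhds (⟨Γ.bind Q, hB⟩ : ProbabilityMeasure X)) := by
  obtain ⟨S, hSc, hSpi, hSb⟩ := exists_countable_isPiSystem_isTopologicalBasis X
  have hS (s : Set X) (hs : s ∈ S) : MeasurableSet s := (hSb.isOpen hs).measurableSet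
  have hmeas (s : Set X) (hs : s ∈ S) : Measurable fun z ↦ (Q z).real s :=
    ((Measure.measurable_coe (hS s hs)).comp hQ).ennreal_toReal
  have h : ∀ᵐ ω ∂(Measure.infinitePi (fun _ : ℕ ↦ Γ)), ∀ s ∈ S,
      Tendsto (fun n : ℕ ↦ ((n + 1 : ℕ) : ℝ)⁻¹ • ∑ i ∈ Finset.range (n + 1), (Q (ω i)).real s)
        atTop (nhds (∫ z, (Q z).real s ∂Γ)) := by
    rw [ae_ball_iff hSc]
    intro s hs
    refine ae_tendsto_average_infinitePi Γ (hmeas s hs) ?_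
    refine Integrable.of_bound (hmeas s hs).aestronglyMeasurable 1 (.of_forall fun z ↦ ?_)
    rw [Real.norm_of_nonneg measureReal_nonneg]
    exact measureReal_le_one
  filter_upwards [h] with ω hω
  refine hSpi.tendsto_probabilityMeasure_of_tendsto_of_mem hS ?_ ?_
  · intro u hu x hx
    obtain ⟨v, hv, hxv, hvu⟩ := hSb.exists_subset_of_mem_open hx hu
    exact ⟨v, hv, (hSb.isOpen hv).mem_nhds hxv, hvu⟩
  · intro s hs
    rw [← NNReal.tendsto_coe]
    have hlim : (Γ.bind Q).real s = ∫ z, (Q z).real s ∂Γ := by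
      rw [measureReal_def]
      rw [Measure.bind_apply (hS s hs) hQ.aemeasurable, ← integral_toReal]
      · rfl
      · exact ((Measure.measurable_coe (hS s hs)).comp hQ).aemeasurable
      · exact .of_forall fun z ↦ measure_lt_top _ _
    change Tendsto (fun n ↦ (uniformMixture (fun i ↦ Q (ω i)) n).real s) atTop
      (nhds ((Γ.bind Q).real s))
    rw [hlim]
    simp_rw [uniformMixture_real_apply _ fun i ↦ hQp (ω i)]
    exact hω s hs

lemma isProbabilityMeasure_bind_of_forall {Z X : Type*} [MeasurableSpace Z] [MeasurableSpace X]
    (Γ : Measure Z) [IsProbabilityMeasure Γ] {Q : Z → Measure X} (hQ : Measurable Q)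
    (hQp : ∀ z, IsProbabilityMeasure (Q z)) : IsProbabilityMeasure (Γ.bind Q) := by
  constructor
  rw [Measure.bind_apply MeasurableSet.univ hQ.aemeasurable]
  simp

/-- Fatou's lemma for weak convergence and a lower semicontinuous integrand. -/
lemma lintegral_le_liminf_of_lowerSemicontinuous {Y : Type*} [TopologicalSpace Y]
    [HasOuterApproxClosed Y] [MeasurableSpace Y] [BorelSpace Y]
    {G : ProbabilityMeasure Y} {Gs : ℕ → ProbabilityMeasure Y} (hG : Tendsto Gs atTop (nhds G))
    {c : Y → ℝ} (hc : LowerSemicontinuous c) (hc0 : ∀ y, 0 ≤ c y) :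
    ∫⁻ y, ENNReal.ofReal (c y) ∂(G : Measure Y)
      ≤ liminf (fun n ↦ ∫⁻ y, ENNReal.ofReal (c y) ∂(Gs n : Measure Y)) atTop := by
  simp_rw [lintegral_eq_lintegral_meas_lt _ (.of_forall hc0) hc.measurable.aemeasurable]
  refine (lintegral_mono fun t ↦ ?_).trans (lintegral_liminf_le fun n ↦ ?_)
  · exact ProbabilityMeasure.le_liminf_measure_open_of_tendsto hG (hc.isOpen_preimage t)
  · exact Antitone.measurable fun s t hst ↦ measure_mono fun ω hω ↦ lt_of_le_of_lt hst hω

/-- Stability of couplings: if the marginals converge weakly and the costs of the couplings are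
bounded by a convergent sequence, then its limit bounds the transport cost of the limits. -/
lemma wassLike_le_of_tendsto {X : Type*} [TopologicalSpace X] [PolishSpace X]
    [MeasurableSpace X] [BorelSpace X] {p q : ProbabilityMeasure X}
    {ps qs : ℕ → ProbabilityMeasure X} (hp : Tendsto ps atTop (nhds p))
    (hq : Tendsto qs atTop (nhds q)) {G : ℕ → Measure (X × X)}
    (hG : ∀ n, IsProbabilityMeasure (G n)) (hGc : ∀ n, IsCoupling (ps n : Measure X) (qs n) (G n))
    {c : X → X → ℝ} (hc : LowerSemicontinuous fun z : X × X ↦ c z.1 z.2) (hc0 : ∀ u v, 0 ≤ c u v)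
    {a : ℕ → ℝ≥0∞} {a' : ℝ≥0∞} (ha : ∀ n, ∫⁻ z, ENNReal.ofReal (c z.1 z.2) ∂(G n) ≤ a n)
    (ha' : Tendsto a atTop (nhds a')) :
    wassLike c (p : Measure X) q ≤ a' := by
  let := TopologicalSpace.upgradeIsCompletelyMetrizable X
  have tight {r : ProbabilityMeasure X} {rs : ℕ → ProbabilityMeasure X}
      (hr : Tendsto rs atTop (nhds r)) :
      IsTightMeasureSet {((μ : ProbabilityMeasure X) : Measure X) | μ ∈ Set.range rs} := by
    refine isTightMeasureSet_of_isCompact_closure ?_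
    exact hr.isCompact_insert_range.closure_of_subset (Set.subset_insert _ _)
  let Gs : ℕ → ProbabilityMeasure (X × X) := fun n ↦ ⟨G n, hG n⟩
  have htight : IsTightMeasureSet
      {((μ : ProbabilityMeasure (X × X)) : Measure (X × X)) | μ ∈ Set.range Gs} := by
    refine IsTightMeasureSet.prodMk ((tight hp).subset ?_) ((tight hq).subset ?_)
    · rintro _ ⟨_, ⟨_, ⟨n, rfl⟩, rfl⟩, rfl⟩
      exact ⟨ps n, ⟨n, rfl⟩, (hGc n).1.symm⟩
    · rintro _ ⟨_, ⟨_, ⟨n, rfl⟩, rfl⟩, rfl⟩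
      exact ⟨qs n, ⟨n, rfl⟩, (hGc n).2.symm⟩
  obtain ⟨L, -, φ, hφ, hL⟩ := (isCompact_closure_of_isTightMeasureSet htight).tendsto_subseq
    (x := Gs) fun n ↦ subset_closure ⟨n, rfl⟩
  have marginal {f : X × X → X} (hf : Continuous f) {r : ProbabilityMeasure X}
      {rs : ℕ → ProbabilityMeasure X} (hr : Tendsto rs atTop (nhds r))
      (h : ∀ n, (G n).map f = rs n) : (L : Measure (X × X)).map f = r := by
    have h1 := ProbabilityMeasure.tendsto_map_of_tendsto_of_continuous _ _ hL hf
    have h2 : (fun n ↦ ((Gs ∘ φ) n).map hf.measurable.aemeasurable) = rs ∘ φ := by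
      ext1 n
      exact Subtype.ext (h (φ n))
    rw [h2] at h1
    have h3 := tendsto_nhds_unique h1 (hr.comp hφ.tendsto_atTop)
    exact congrArg (fun μ : ProbabilityMeasure X ↦ (μ : Measure X)) h3
  have hLc : IsCoupling (p : Measure X) q L :=
    ⟨marginal continuous_fst hp fun n ↦ (hGc n).1, marginal continuous_snd hq fun n ↦ (hGc n).2⟩
  refine (iInf_le_of_le (L : Measure (X × X)) <| iInf_le_of_le L.2 <|
    iInf_le_of_le hLc le_rfl).trans ?_
  refine (lintegral_le_liminf_of_lowerSemicontinuous hL hc fun z ↦ hc0 z.1 z.2).trans ?_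
  rw [← (ha'.comp hφ.tendsto_atTop).liminf_eq]
  exact liminf_le_liminf (.of_forall fun n ↦ ha (φ n))

lemma exists_isCoupling_lintegral_lt {X : Type*} [MeasurableSpace X] {c : X → X → ℝ}
    {p q : Measure X} {a : ℝ≥0∞} (h : wassLike c p q < a) :
    ∃ G : Measure (X × X), IsProbabilityMeasure G ∧ IsCoupling p q G ∧
      ∫⁻ z, ENNReal.ofReal (c z.1 z.2) ∂G < a := by
  simp only [wassLike, iInf_lt_iff] at h
  obtain ⟨G, h1, h2, h3⟩ := h
  exact ⟨G, h1, h2, h3⟩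

/-- Convexity of the optimal transport cost along a Markov kernel. -/
lemma wassLike_bind_le_lintegral {X : Type*} [TopologicalSpace X] [PolishSpace X]
    [MeasurableSpace X] [BorelSpace X] {c d : X → X → ℝ}
    (hc : LowerSemicontinuous fun z : X × X ↦ c z.1 z.2) (hc0 : ∀ u v, 0 ≤ c u v)
    (hd : Measurable fun z : X × X ↦ d z.1 z.2) (hd0 : ∀ u v, 0 ≤ d u v)
    {Q : X → Measure X} (hQ : IsMarkovKernelFun Q)
    (h : ∀ u v, wassLike c (Q u) (Q v) ≤ ENNReal.ofReal (d u v))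
    {μ ν : Measure X} {Γ : Measure (X × X)} (hΓ : IsProbabilityMeasure Γ)
    (hΓc : IsCoupling μ ν Γ) :
    wassLike c (μ.bind Q) (ν.bind Q) ≤ ∫⁻ z, ENNReal.ofReal (d z.1 z.2) ∂Γ := by
  by_cases hfin : ∫⁻ z, ENNReal.ofReal (d z.1 z.2) ∂Γ = ∞
  · simp [hfin]
  have hint : Integrable (fun z : X × X ↦ d z.1 z.2) Γ := by
    refine ⟨hd.aestronglyMeasurable, ?_⟩
    rw [hasFiniteIntegral_iff_ofReal (f := fun z : X × X ↦ d z.1 z.2)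
      (.of_forall fun z ↦ hd0 z.1 z.2)]
    exact lt_top_iff_ne_top.2 hfin
  have hbind {f : X × X → X} (hf : Measurable f) {r : Measure X} (hr : Γ.map f = r) :
      Γ.bind (fun z ↦ Q (f z)) = r.bind Q := by
    ext s hs
    have hm : Measurable fun u ↦ Q u s := (Measure.measurable_coe hs).comp hQ.1
    have hQf : Measurable fun z ↦ Q (f z) := hQ.1.comp hf
    rw [Measure.bind_apply hs hQf.aemeasurable, Measure.bind_apply hs hQ.1.aemeasurable,
      ← hr, lintegral_map hm hf]
  have hQ1 : Measurable fun z : X × X ↦ Q z.1 := hQ.1.comp measurable_fst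
  have hQ2 : Measurable fun z : X × X ↦ Q z.2 := hQ.1.comp measurable_snd
  have hB1 := isProbabilityMeasure_bind_of_forall Γ hQ1 fun z ↦ hQ.2 z.1
  have hB2 := isProbabilityMeasure_bind_of_forall Γ hQ2 fun z ↦ hQ.2 z.2
  obtain ⟨ω, hω1, hω2, hω3⟩ :=
    ((ae_tendsto_uniformMixture Γ hQ1 (fun z ↦ hQ.2 z.1) hB1).and
    ((ae_tendsto_uniformMixture Γ hQ2 (fun z ↦ hQ.2 z.2) hB2).and
    (ae_tendsto_average_infinitePi Γ hd hint))).exists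
  rw [← hbind measurable_fst hΓc.1, ← hbind measurable_snd hΓc.2]
  rw [← ofReal_integral_eq_lintegral_ofReal hint (.of_forall fun z ↦ hd0 z.1 z.2)]
  refine ENNReal.le_of_forall_pos_le_add fun ε hε _ ↦ ?_
  have hlt (i : ℕ) : wassLike c (Q (ω i).1) (Q (ω i).2)
      < ENNReal.ofReal (d (ω i).1 (ω i).2) + ε :=
    (h _ _).trans_lt (ENNReal.lt_add_right ENNReal.ofReal_ne_top (by simpa using hε.ne'))
  choose G hG hGc hGle using fun i ↦ exists_isCoupling_lintegral_lt (hlt i)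
  refine wassLike_le_of_tendsto hω1 hω2 (G := uniformMixture G)
    (isProbabilityMeasure_uniformMixture G hG) ?_ hc hc0
    (a := fun n ↦ ENNReal.ofReal (((n + 1 : ℕ) : ℝ)⁻¹ •
      ∑ i ∈ Finset.range (n + 1), d (ω i).1 (ω i).2) + ε) ?_
    ((ENNReal.tendsto_ofReal hω3).add tendsto_const_nhds)
  · intro n
    constructor
    · rw [map_uniformMixture G n measurable_fst]
      simp_rw [fun i ↦ (hGc i).1]
      rfl
    · rw [map_uniformMixture G n measurable_snd]
      simp_rw [fun i ↦ (hGc i).2]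
      rfl
  · intro n
    rw [lintegral_uniformMixture]
    have hsum : ENNReal.ofReal (((n + 1 : ℕ) : ℝ)⁻¹ •
        ∑ i ∈ Finset.range (n + 1), d (ω i).1 (ω i).2) + ε
        = ((n + 1 : ℕ) : ℝ≥0∞)⁻¹ *
          ∑ i ∈ Finset.range (n + 1), (ENNReal.ofReal (d (ω i).1 (ω i).2) + ε) := by
      rw [smul_eq_mul, ENNReal.ofReal_mul (by positivity),
        ENNReal.ofReal_sum_of_nonneg fun i _ ↦ hd0 _ _, Finset.sum_add_distrib, mul_add,
        ENNReal.ofReal_inv_of_pos (by positivity), ENNReal.ofReal_natCast]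
      congr 1
      rw [Finset.sum_const, Finset.card_range, nsmul_eq_mul, ← mul_assoc,
        ENNReal.inv_mul_cancel (by simp) (ENNReal.natCast_ne_top _), one_mul]
    rw [hsum]
    gcongr with i _
    exact (hGle i).le

/-- A pointwise contraction estimate for a Markov kernel lifts to all probability measures. -/
lemma wassLike_bind_le_mul {X : Type*} [TopologicalSpace X] [PolishSpace X]
    [MeasurableSpace X] [BorelSpace X] {c d : X → X → ℝ} {κ : ℝ} (hκ : 0 < κ)
    (hc : LowerSemicontinuous fun z : X × X ↦ c z.1 z.2) (hc0 : ∀ u v, 0 ≤ c u v)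
    (hd : Measurable fun z : X × X ↦ d z.1 z.2) (hd0 : ∀ u v, 0 ≤ d u v)
    {Q : X → Measure X} (hQ : IsMarkovKernelFun Q)
    (h : ∀ u v, wassLike c (Q u) (Q v) ≤ ENNReal.ofReal (κ * d u v)) (μ ν : Measure X) :
    wassLike c (μ.bind Q) (ν.bind Q) ≤ ENNReal.ofReal κ * wassLike d μ ν := by
  have hκ0 : ENNReal.ofReal κ ≠ 0 := by simpa using hκ
  rw [mul_comm, ← ENNReal.div_le_iff hκ0 ENNReal.ofReal_ne_top]
  refine le_iInf fun Γ ↦ le_iInf fun hΓ ↦ le_iInf fun hΓc ↦ ?_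
  rw [ENNReal.div_le_iff hκ0 ENNReal.ofReal_ne_top, mul_comm]
  refine (wassLike_bind_le_lintegral (d := fun u v ↦ κ * d u v) hc hc0 (hd.const_mul κ)
    (fun u v ↦ mul_nonneg hκ.le (hd0 u v)) hQ h hΓ hΓc).trans_eq ?_
  simp_rw [ENNReal.ofReal_mul hκ.le]
  exact lintegral_const_mul _ hd.ennreal_ofReal

lemma wassLike_le_one {X : Type*} [MeasurableSpace X] {ρ : X → X → ℝ} (hρ : ∀ u v, ρ u v ≤ 1)
    (p q : Measure X) [IsProbabilityMeasure p] [IsProbabilityMeasure q] :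
    wassLike ρ p q ≤ 1 := by
  have hpq : IsCoupling p q (p.prod q) := by
    constructor
    · rw [Measure.map_fst_prod]; simp
    · rw [Measure.map_snd_prod]; simp
  refine (iInf_le_of_le (p.prod q) <| iInf_le_of_le (inferInstance : IsProbabilityMeasure _) <|
    iInf_le_of_le hpq le_rfl).trans ?_
  calc ∫⁻ z, ENNReal.ofReal (ρ z.1 z.2) ∂(p.prod q) ≤ ∫⁻ _, 1 ∂(p.prod q) :=
        lintegral_mono fun z ↦ by simpa using hρ z.1 z.2
    _ = 1 := by simp

lemma lintegral_mul_le_sqrt_mul_sqrt {Y : Type*} [MeasurableSpace Y] (μ : Measure Y)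
    {f g : Y → ℝ≥0∞} (hf : Measurable f) (hg : Measurable g) :
    ∫⁻ y, f y * g y ∂μ
      ≤ (∫⁻ y, f y ^ 2 ∂μ) ^ (2⁻¹ : ℝ) * (∫⁻ y, g y ^ 2 ∂μ) ^ (2⁻¹ : ℝ) := by
  have h := ENNReal.lintegral_mul_le_Lp_mul_Lq μ Real.HolderConjugate.two_two
    hf.aemeasurable hg.aemeasurable
  simpa only [Pi.mul_apply, ENNReal.rpow_ofNat, one_div] using h

lemma ofReal_exp_rpow_half (x : ℝ) :
    ENNReal.ofReal (Real.exp x) ^ (2⁻¹ : ℝ) = ENNReal.ofReal (Real.exp (x / 2)) := by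
  rw [ENNReal.ofReal_rpow_of_pos (Real.exp_pos x), ← Real.exp_mul, div_eq_mul_inv]

/-- Interpolation of the weighted cost between the unweighted cost and exponential moments. -/
lemma wassLike_expWeight_le {X : Type*} [NormedAddCommGroup X] [SecondCountableTopology X]
    [MeasurableSpace X] [BorelSpace X] {ρ : X → X → ℝ} (hρ : DistanceLike ρ)
    {p q : Measure X} {α a b w : ℝ}
    (hp : ∫⁻ u, ENNReal.ofReal (Real.exp (4 * α * ‖u‖ ^ 2)) ∂p
      ≤ ENNReal.ofReal (Real.exp (4 * α * a)))
    (hq : ∫⁻ u, ENNReal.ofReal (Real.exp (4 * α * ‖u‖ ^ 2)) ∂q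
      ≤ ENNReal.ofReal (Real.exp (4 * α * b)))
    (hw : wassLike ρ p q ≤ ENNReal.ofReal w) :
    wassLike (expWeight ρ α) p q ≤ ENNReal.ofReal (Real.sqrt w * Real.exp (α * (a + b))) := by
  set E : ℝ≥0∞ := ENNReal.ofReal (Real.exp (α * (a + b))) with hE
  have hE0 : E ≠ 0 := by simp [hE, Real.exp_pos]
  have hEt : E ≠ ∞ := ENNReal.ofReal_ne_top
  have hρm : Measurable fun z : X × X ↦ ρ z.1 z.2 := hρ.2.2.1.measurable
  have key (G : Measure (X × X)) (hGp : IsProbabilityMeasure G) (hG : IsCoupling p q G) :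
      wassLike (expWeight ρ α) p q
        ≤ (∫⁻ z, ENNReal.ofReal (ρ z.1 z.2) ∂G) ^ (2⁻¹ : ℝ) * E := by
    have hmom {f : X × X → X} (hf : Measurable f) {r : Measure X} (hr : G.map f = r) {x : ℝ}
        (hx : ∫⁻ u, ENNReal.ofReal (Real.exp (4 * α * ‖u‖ ^ 2)) ∂r
          ≤ ENNReal.ofReal (Real.exp (4 * α * x))) :
        (∫⁻ z, ENNReal.ofReal (Real.exp (2 * α * ‖f z‖ ^ 2)) ^ 2 ∂G) ^ (2⁻¹ : ℝ)
          ≤ ENNReal.ofReal (Real.exp (2 * α * x)) := by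
      have h1 : ∫⁻ z, ENNReal.ofReal (Real.exp (2 * α * ‖f z‖ ^ 2)) ^ 2 ∂G
          = ∫⁻ u, ENNReal.ofReal (Real.exp (4 * α * ‖u‖ ^ 2)) ∂r := by
        rw [← hr, lintegral_map (by fun_prop) hf]
        refine lintegral_congr fun z ↦ ?_
        rw [← ENNReal.ofReal_pow (Real.exp_pos _).le, ← Real.exp_nat_mul]
        congr 2
        push_cast
        ring
      rw [h1]
      calc _ ≤ ENNReal.ofReal (Real.exp (4 * α * x)) ^ (2⁻¹ : ℝ) := by gcongr
        _ = _ := by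
          rw [ofReal_exp_rpow_half]
          congr 2
          ring
    have hsq : (∫⁻ z : X × X, ENNReal.ofReal (Real.exp (α * ‖z.1‖ ^ 2 + α * ‖z.2‖ ^ 2)) ^ 2 ∂G)
        ≤ ENNReal.ofReal (Real.exp (2 * α * a)) * ENNReal.ofReal (Real.exp (2 * α * b)) := by
      have h1 (z : X × X) : ENNReal.ofReal (Real.exp (α * ‖z.1‖ ^ 2 + α * ‖z.2‖ ^ 2)) ^ 2
          = ENNReal.ofReal (Real.exp (2 * α * ‖z.1‖ ^ 2)) *
            ENNReal.ofReal (Real.exp (2 * α * ‖z.2‖ ^ 2)) := by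
        rw [← ENNReal.ofReal_pow (Real.exp_pos _).le, ← Real.exp_nat_mul,
          ← ENNReal.ofReal_mul (Real.exp_pos _).le, ← Real.exp_add]
        congr 2
        push_cast
        ring
      simp_rw [h1]
      refine (lintegral_mul_le_sqrt_mul_sqrt G (by fun_prop) (by fun_prop)).trans ?_
      exact mul_le_mul' (hmom measurable_fst hG.1 hp) (hmom measurable_snd hG.2 hq)
    refine (iInf_le_of_le G <| iInf_le_of_le hGp <| iInf_le_of_le hG le_rfl).trans ?_
    calc ∫⁻ z, ENNReal.ofReal (expWeight ρ α z.1 z.2) ∂G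
        = ∫⁻ z, ENNReal.ofReal (Real.sqrt (ρ z.1 z.2)) *
            ENNReal.ofReal (Real.exp (α * ‖z.1‖ ^ 2 + α * ‖z.2‖ ^ 2)) ∂G := by
          simp_rw [expWeight, ENNReal.ofReal_mul (Real.sqrt_nonneg _)]
      _ ≤ _ := lintegral_mul_le_sqrt_mul_sqrt G (hρm.sqrt.ennreal_ofReal) (by fun_prop)
      _ ≤ _ := by
          gcongr
          · rw [← ENNReal.ofReal_pow (Real.sqrt_nonneg _), Real.sq_sqrt (hρ.1 _ _)]
          · calc _ ≤ (ENNReal.ofReal (Real.exp (2 * α * a)) *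
                  ENNReal.ofReal (Real.exp (2 * α * b))) ^ (2⁻¹ : ℝ) := by gcongr
              _ = E := by
                rw [← ENNReal.ofReal_mul (Real.exp_pos _).le, ← Real.exp_add,
                  ofReal_exp_rpow_half, hE]
                congr 2
                ring
  have hW : (wassLike (expWeight ρ α) p q / E) ^ (2 : ℝ) ≤ wassLike ρ p q := by
    refine le_iInf fun G ↦ le_iInf fun hGp ↦ le_iInf fun hG ↦ ?_
    rw [← ENNReal.le_rpow_inv_iff two_pos, ENNReal.div_le_iff hE0 hEt]
    exact key G hGp hG
  have h2 := hW.trans hw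
  rw [← ENNReal.le_rpow_inv_iff two_pos, ENNReal.div_le_iff hE0 hEt] at h2
  rw [ENNReal.ofReal_mul (Real.sqrt_nonneg _)]
  refine h2.trans ?_
  gcongr
  rcases le_total 0 w with hw0 | hw0
  · rw [ENNReal.ofReal_rpow_of_nonneg hw0 (by norm_num), Real.sqrt_eq_rpow, one_div]
  · rw [ENNReal.ofReal_of_nonpos hw0, ENNReal.zero_rpow_of_pos (by norm_num)]
    exact zero_le

lemma lowerSemicontinuous_expWeight {X : Type*} [NormedAddCommGroup X] {ρ : X → X → ℝ}
    (hρ : DistanceLike ρ) (a : ℝ) :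
    LowerSemicontinuous fun z : X × X ↦ expWeight ρ a z.1 z.2 := by
  have hs : LowerSemicontinuous fun z : X × X ↦ Real.sqrt (ρ z.1 z.2) :=
    Real.continuous_sqrt.comp_lowerSemicontinuous hρ.2.2.1 Real.sqrt_monotone
  refine lowerSemicontinuous_iff_isOpen_preimage.2 fun y ↦ ?_
  have hcont : Continuous fun z : X × X ↦ -(y * Real.exp (-(a * ‖z.1‖ ^ 2 + a * ‖z.2‖ ^ 2))) := by
    fun_prop
  convert! (hs.add hcont.lowerSemicontinuous).isOpen_preimage 0 using 1
  ext z
  simp only [Set.mem_preimage, Set.mem_Ioi, expWeight, Real.exp_neg]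
  rw [← sub_eq_add_neg, sub_pos, ← div_eq_mul_inv, div_lt_iff₀ (Real.exp_pos _)]

lemma expWeight_nonneg {X : Type*} [NormedAddCommGroup X] (ρ : X → X → ℝ) (a : ℝ) (u v : X) :
    0 ≤ expWeight ρ a u v :=
  mul_nonneg (Real.sqrt_nonneg _) (Real.exp_pos _).le

/-- The contraction estimate for transition probabilities at time `t`, from moment bounds and the
two smallness conditions on the transport cost. -/
lemma wassLike_expWeight_le_mul {X : Type*} [NormedAddCommGroup X] [SecondCountableTopology X]
    [MeasurableSpace X] [BorelSpace X] {ρ : X → X → ℝ} (hρ : DistanceLike ρ)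
    (hρ1 : ∀ u v, ρ u v ≤ 1) {Q : X → Measure X} (hQ : IsMarkovKernelFun Q)
    {α m C s κ₁ : ℝ} (hα : 0 < α) (hm : 1 ≤ m) (hC : 0 < C)
    (hs : s ≤ 1 / (2 * m))
    (hmom : ∀ u₀, ∫⁻ u, ENNReal.ofReal (Real.exp (4 * α * ‖u‖ ^ 2)) ∂(Q u₀)
      ≤ ENNReal.ofReal (Real.exp (4 * α * (s * ‖u₀‖ ^ 2 + C))))
    (hsmall : ∀ u₀ v₀, ‖u₀‖ ≤ Real.sqrt (6 * m * C) → ‖v₀‖ ≤ Real.sqrt (6 * m * C) →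
      wassLike ρ (Q u₀) (Q v₀) ≤ ENNReal.ofReal (1 - κ₁))
    (hκ₁ : κ₁ < 1) (hακ₁ : 8 * C * α ≤ -Real.log (1 - κ₁))
    (hcontr : ∀ u₀ v₀, ρ u₀ v₀ < 1 → wassLike ρ (Q u₀) (Q v₀)
      ≤ ENNReal.ofReal (Real.exp (-(6 * C * α)) * Real.exp (α / m * ‖u₀‖ ^ 2) * ρ u₀ v₀))
    (u v : X) :
    wassLike (expWeight ρ α) (Q u) (Q v)
      ≤ ENNReal.ofReal (Real.exp (-(C * α)) * expWeight ρ (α / m) u v) := by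
  have hm0 : 0 < m := by linarith
  have hβ : 0 < α / m := by positivity
  have hαs : α * s ≤ α / m / 2 :=
    (mul_le_mul_of_nonneg_left hs hα.le).trans_eq (by field_simp)
  have bound {w : ℝ} (hw : wassLike ρ (Q u) (Q v) ≤ ENNReal.ofReal w) :=
    wassLike_expWeight_le hρ (hmom u) (hmom v) hw
  have sqrt_exp (x : ℝ) : Real.sqrt (Real.exp x) = Real.exp (x / 2) := by
    rw [Real.exp_half]
  have hu := mul_le_mul_of_nonneg_right hαs (sq_nonneg ‖u‖)
  have hv := mul_le_mul_of_nonneg_right hαs (sq_nonneg ‖v‖)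
  have hu0 : 0 ≤ α / m * ‖u‖ ^ 2 := by positivity
  have hv0 : 0 ≤ α / m * ‖v‖ ^ 2 := by positivity
  rcases lt_or_eq_of_le (hρ1 u v) with h1 | h1
  · refine (bound (hcontr u v h1)).trans (ENNReal.ofReal_le_ofReal ?_)
    rw [← Real.exp_add, Real.sqrt_mul (Real.exp_pos _).le, sqrt_exp, expWeight, mul_right_comm,
      ← Real.exp_add, mul_left_comm, ← Real.exp_add, mul_comm]
    refine mul_le_mul_of_nonneg_left (Real.exp_le_exp.2 ?_) (Real.sqrt_nonneg _)
    linarith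
  · rw [expWeight, h1, Real.sqrt_one, one_mul, ← Real.exp_add]
    by_cases hM : 6 * m * C ≤ ‖u‖ ^ 2 + ‖v‖ ^ 2
    · have := hQ.2 u
      have := hQ.2 v
      refine (bound (w := 1) (by simpa using wassLike_le_one hρ1 (Q u) (Q v))).trans
        (ENNReal.ofReal_le_ofReal ?_)
      rw [Real.sqrt_one, one_mul]
      refine Real.exp_le_exp.2 ?_
      have h6 : 6 * C * α ≤ α / m * (‖u‖ ^ 2 + ‖v‖ ^ 2) :=
        le_of_eq_of_le (by field_simp) (mul_le_mul_of_nonneg_left hM hβ.le)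
      linarith
    · have hle := (not_le.1 hM).le
      have hub : ‖u‖ ≤ Real.sqrt (6 * m * C) :=
        Real.le_sqrt_of_sq_le (by linarith [sq_nonneg ‖v‖])
      have hvb : ‖v‖ ≤ Real.sqrt (6 * m * C) :=
        Real.le_sqrt_of_sq_le (by linarith [sq_nonneg ‖u‖])
      refine (bound (hsmall u v hub hvb)).trans (ENNReal.ofReal_le_ofReal ?_)
      rw [← Real.exp_log (sub_pos.2 hκ₁), sqrt_exp, ← Real.exp_add]
      refine Real.exp_le_exp.2 ?_
      have : 0 < C * α := by positivity
      linarith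

/-- Weak Harris theorem, contraction form (Theorem 2.2, inequality (2.9)):
under an exponential Lyapunov structure (A1), eventual ρ-smallness of bounded sets (A2)
and eventual local ρ-contractivity (A3.i), the Markov semigroup is a contraction
from `W_{ρ_{α/m}}` to `W_{ρ_α}` after a sufficiently large time. -/
theorem weak_harris_contraction
    {X : Type*} [NormedAddCommGroup X] [NormedSpace ℝ X] [CompleteSpace X]
    [SecondCountableTopology X] [MeasurableSpace X] [BorelSpace X]
    (I : Set ℝ) (hI : I ⊆ Set.Ici (0 : ℝ))
    (P : ℝ → X → Measure X)
    (hker : ∀ t ∈ I, IsMarkovKernelFun (P t))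
    (hP0 : (0 : ℝ) ∈ I → ∀ u : X, P 0 u = Measure.dirac u)
    (hCK : ∀ t ∈ I, ∀ s ∈ I, t + s ∈ I →
      ∀ u : X, P (t + s) u = (P t u).bind (P s))
    (Λ : Set (X → X → ℝ))
    (hΛ : ∀ ρ ∈ Λ, DistanceLike ρ ∧ ∀ u v : X, ρ u v ≤ 1)
    -- (A1) exponential Lyapunov structure
    (ψ : ℝ → ℝ) (hψc : Continuous ψ) (hψ0 : ∀ t, 0 ≤ ψ t)
    (hψlim : Tendsto ψ atTop (nhds 0))
    (α₀ C₀ : ℝ) (hα₀ : 0 < α₀) (hC₀ : 0 < C₀)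
    (hA1 : ∀ α ∈ Set.Ioc (0 : ℝ) α₀, ∀ t ∈ I, ∀ u₀ : X,
      ∫⁻ u, ENNReal.ofReal (Real.exp (α * ‖u‖ ^ 2)) ∂(P t u₀)
        ≤ ENNReal.ofReal (Real.exp (α * (ψ t * ‖u₀‖ ^ 2 + C₀))))
    -- (A2) eventual ρ-smallness of bounded sets
    (hA2 : ∀ M > (0 : ℝ), ∃ κ₁ ∈ Set.Ioo (0 : ℝ) 1, ∀ ρ ∈ Λ, ∃ T₁ > (0 : ℝ),
      ∀ t ∈ I, T₁ ≤ t → ∀ u₀ v₀ : X, ‖u₀‖ ≤ M → ‖v₀‖ ≤ M →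
        wassLike ρ (P t u₀) (P t v₀) ≤ ENNReal.ofReal (1 - κ₁))
    -- (A3.i) eventual local ρ-contractivity
    (hA3i : ∀ κ₂ ∈ Set.Ioo (0 : ℝ) 1, ∀ r > (0 : ℝ), ∃ ρ ∈ Λ, ∃ T₂ > (0 : ℝ),
      ∀ t ∈ I, T₂ ≤ t → ∀ u₀ v₀ : X, ρ u₀ v₀ < 1 →
        wassLike ρ (P t u₀) (P t v₀)
          ≤ ENNReal.ofReal (κ₂ * Real.exp (r * ‖u₀‖ ^ 2) * ρ u₀ v₀)) :
    ∀ m : ℝ, 1 ≤ m → ∃ αm > (0 : ℝ), ∀ α ∈ Set.Ioc (0 : ℝ) αm, ∃ ρ ∈ Λ,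
      ∃ κ ∈ Set.Ioo (0 : ℝ) 1, ∃ T > (0 : ℝ), ∀ t ∈ I, T ≤ t →
        ∀ μ ν : Measure X, IsProbabilityMeasure μ → IsProbabilityMeasure ν →
          wassLike (expWeight ρ α) (μ.bind (P t)) (ν.bind (P t))
            ≤ ENNReal.ofReal κ * wassLike (expWeight ρ (α / m)) μ ν := by
  intro m hm
  have hm0 : 0 < m := by linarith
  obtain ⟨κ₁, ⟨hκ₁0, hκ₁1⟩, hsmall⟩ := hA2 (Real.sqrt (6 * m * C₀)) (Real.sqrt_pos.2 (by positivity))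
  have hlog : 0 < -Real.log (1 - κ₁) :=
    neg_pos.2 (Real.log_neg (sub_pos.2 hκ₁1) (by linarith))
  refine ⟨min (α₀ / 4) (-Real.log (1 - κ₁) / (8 * C₀)), lt_min (by positivity) (by positivity), ?_⟩
  rintro α ⟨hα, hαle⟩
  have hα4 : 4 * α ∈ Set.Ioc 0 α₀ := ⟨by positivity, by linarith [hαle.trans (min_le_left _ _)]⟩
  have hαlog : 8 * C₀ * α ≤ -Real.log (1 - κ₁) := by
    rw [← le_div_iff₀' (by positivity)]
    exact hαle.trans (min_le_right _ _)
  have hexp {c : ℝ} (hc : 0 < c) : Real.exp (-c) ∈ Set.Ioo (0 : ℝ) 1 :=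
    ⟨Real.exp_pos _, Real.exp_lt_one_iff.2 (neg_lt_zero.2 hc)⟩
  obtain ⟨ρ, hρΛ, T₂, hT₂, hcontr⟩ := hA3i (Real.exp (-(6 * C₀ * α))) (hexp (by positivity))
    (α / m) (by positivity)
  obtain ⟨T₁, -, hsmall⟩ := hsmall ρ hρΛ
  obtain ⟨T₀, hT₀⟩ := eventually_atTop.1
    (hψlim.eventually_le_const (show (0 : ℝ) < 1 / (2 * m) by positivity))
  obtain ⟨hρ, hρ1⟩ := hΛ ρ hρΛ
  refine ⟨ρ, hρΛ, Real.exp (-(C₀ * α)), hexp (by positivity), max T₂ (max T₁ T₀),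
    lt_max_of_lt_left hT₂, fun t ht hTt μ ν _ _ ↦ ?_⟩
  refine wassLike_bind_le_mul (Real.exp_pos _) (lowerSemicontinuous_expWeight hρ α)
    (expWeight_nonneg ρ α) (lowerSemicontinuous_expWeight hρ (α / m)).measurable
    (expWeight_nonneg ρ (α / m)) (hker t ht) ?_ μ ν
  exact wassLike_expWeight_le_mul hρ hρ1 (hker t ht) hα hm hC₀
    (hT₀ t ((le_max_right _ _).trans ((le_max_right _ _).trans hTt))) (hA1 (4 * α) hα4 t ht)
    (hsmall t ht ((le_max_left _ _).trans ((le_max_right _ _).trans hTt))) hκ₁1 hαlog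
    (hcontr t ht ((le_max_left _ _).trans hTt))
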